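/- arXiv:math/0404285 — 6 statements merged into one kernel-verified Lean document; each statement's English description precedes it below -/
import Mathlib

section
/- For every natural number k, the sum over all permutations σ in the symmetric group S_k of 2^{c(σ)} equals (k+1)!. -/
open Equiv Finset

/-- The number of cycles (orbits) of a permutation, counting fixed points
as orbits of size one. -/
noncomputable def Equiv.Perm.numCycles {α : Type*} (σ : Equiv.Perm α) : ℕ :=
  Nat.card (Quotient (Equiv.Perm.SameCycle.setoid σ))

/-- The size of the orbit of `x` under the permutation `σ`. -/
noncomputable def Equiv.Perm.orbitSize {α : Type*} (σ : Equiv.Perm α) (x : α) : ℕ :=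
  Nat.card {y // σ.SameCycle x y}

theorem Equiv.Perm.orbitSize_congr {α : Type*} (σ : Equiv.Perm α) {a b : α}
    (h : σ.SameCycle a b) : σ.orbitSize a = σ.orbitSize b :=
  Nat.card_congr (Equiv.subtypeEquivRight fun y =>
    ⟨fun hy => h.symm.trans hy, fun hy => h.trans hy⟩)

/-- The number of orbits of the permutation `σ` of size exactly `j`. -/
noncomputable def Equiv.Perm.numOrbits {α : Type*} (σ : Equiv.Perm α) (j : ℕ) : ℕ :=
  Nat.card {ω : Quotient (Equiv.Perm.SameCycle.setoid σ) //
    Quotient.liftOn ω σ.orbitSize (fun _ _ h => σ.orbitSize_congr h) = j}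

/-- Every orbit of the permutation `σ` has even size. -/
def Equiv.Perm.allOrbitsEven {α : Type*} (σ : Equiv.Perm α) : Prop :=
  ∀ x : α, Even (σ.orbitSize x)

/-- The functions invariant under `σ` correspond to the functions on the set of orbits of `σ`. -/
theorem Equiv.Perm.card_comp_eq_self {α β : Type*} [Finite α] (σ : Equiv.Perm α) :
    Nat.card {f : α → β // f ∘ σ = f} = Nat.card β ^ σ.numCycles := by
  have key (f : α → β) :
      f ∘ σ = f ↔ Equiv.Perm.SameCycle.setoid σ ≤ Setoid.ker f := by
    refine ⟨fun h x y hxy => ?_, fun h => funext fun x => ?_⟩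
    · obtain ⟨n, rfl⟩ := hxy.exists_nat_pow_eq
      rw [Setoid.ker_def, Equiv.Perm.coe_pow]
      exact (congrFun (Function.iterate_invariant h n) x).symm
    · exact (h (Equiv.Perm.sameCycle_apply_right.2 (Equiv.Perm.SameCycle.refl σ x))).symm
  rw [Nat.card_congr ((Equiv.subtypeEquivRight key).trans (Setoid.liftEquiv _)), Nat.card_fun,
    Equiv.Perm.numCycles]

/-- The numbers of permutations preserving each of the two-colourings of a finite type add up to
`(k + 1)!`, where `k` is the size of the type. -/
theorem Equiv.Perm.sum_card_comp_eq_self {α : Type*} [Fintype α] [DecidableEq α] :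
    ∑ f : α → Bool, Fintype.card {σ : Equiv.Perm α // f ∘ σ = f} =
      (Fintype.card α + 1).factorial := by
  have hs (f : α → Bool) : Fintype.card {σ : Equiv.Perm α // f ∘ σ = f} =
      (#{a | f a = true}).factorial * (Fintype.card α - #{a | f a = true}).factorial := by
    rw [DomMulAct.stabilizer_card, Fintype.prod_bool, Fintype.card_subtype, Fintype.card_subtype,
      ← Finset.card_compl, Finset.compl_filter]
    simp only [Bool.not_eq_true]
  calc
    _ = ∑ s ∈ (univ : Finset α).powerset, (#s).factorial * (Fintype.card α - #s).factorial := by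
      refine Finset.sum_bij' (fun f _ => ({a | f a = true} : Finset α)) (fun s _ a => decide (a ∈ s))
        ?_ ?_ ?_ ?_ fun f _ => hs f <;> simp
    _ = ∑ _m ∈ range (Fintype.card α + 1), (Fintype.card α).factorial := by
      rw [Finset.sum_powerset_apply_card
        (fun m => m.factorial * (Fintype.card α - m).factorial), Finset.card_univ]
      refine Finset.sum_congr rfl fun m hm => ?_
      rw [smul_eq_mul, ← mul_assoc,
        Nat.choose_mul_factorial_mul_factorial (Finset.mem_range_succ_iff.1 hm)]
    _ = _ := by rw [Finset.sum_const, Finset.card_range, smul_eq_mul, Nat.factorial_succ]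

/-- For every natural number `k`, the sum over all permutations `σ` of a `k`-element
set of `2 ^ c(σ)`, where `c(σ)` is the number of cycles of `σ`, equals `(k+1)!`. -/
theorem sum_two_pow_numCycles (k : ℕ) :
    ∑ σ : Equiv.Perm (Fin k), 2 ^ σ.numCycles = Nat.factorial (k + 1) := by
  calc
    _ = ∑ σ : Equiv.Perm (Fin k), ∑ f : Fin k → Bool, if f ∘ σ = f then 1 else 0 := by
      refine Finset.sum_congr rfl fun σ _ => ?_
      rw [← Finset.card_filter, ← Fintype.card_subtype, ← Nat.card_eq_fintype_card,
        Equiv.Perm.card_comp_eq_self, Nat.card_eq_fintype_card, Fintype.card_bool]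
    _ = ∑ f : Fin k → Bool, Fintype.card {σ : Equiv.Perm (Fin k) // f ∘ σ = f} := by
      rw [Finset.sum_comm]
      simp only [← Finset.card_filter, ← Fintype.card_subtype]
    _ = _ := by rw [Equiv.Perm.sum_card_comp_eq_self, Fintype.card_fin]
end

section
/- For every natural number k ≥ 1, the sum of 2^{c(σ)} over all permutations σ in S_k all of whose orbits have even size equals k! if k is even, and equals 0 (i.e. there are no such permutations) if k is odd. -/
open Equiv Finset

namespace Equiv.Perm

variable {α : Type*}

theorem orbitSize_dvd_iff [Finite α] (σ : Perm α) (x : α) (n : ℤ) :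
    (σ.orbitSize x : ℤ) ∣ n ↔ (σ ^ n) x = x := by
  have h : σ.orbitSize x = Function.minimalPeriod (σ • ·) x := by
    have := Fintype.ofFinite (MulAction.orbit (Subgroup.zpowers σ) x)
    rw [MulAction.minimalPeriod_eq_card, ← Nat.card_eq_fintype_card]
    refine Nat.card_congr (Equiv.subtypeEquivRight fun y => ?_)
    simp [MulAction.mem_orbit_iff, SameCycle, Subgroup.smul_def]
  rw [h, ← MulAction.zpow_smul_eq_iff_minimalPeriod_dvd]
  rfl

/-- The colouring `f` alternates along the orbits of `σ`. -/
def IsAlternating (σ : Perm α) (f : α → Bool) : Prop :=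
  ∀ x, f (σ x) = !f x

theorem IsAlternating.zpow_apply {σ : Perm α} {f : α → Bool} (h : σ.IsAlternating f)
    (n : ℤ) (x : α) : f ((σ ^ n) x) = (f x ^^ decide (¬Even n)) := by
  induction n with
  | zero => simp
  | succ n ih =>
    rw [zpow_add_one, (Commute.self_zpow σ _).eq.symm, mul_apply, h, ih]
    by_cases hn : Even n <;> simp [hn]
  | pred n ih =>
    have h2 := h ((σ ^ (-(n : ℤ) - 1)) x)
    rw [← mul_apply, ← zpow_one_add, add_sub_cancel, ih] at h2
    rw [← Bool.not_not (f ((σ ^ (-(n : ℤ) - 1)) x)), ← h2]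
    by_cases hn : Even n <;> simp [hn]

theorem IsAlternating.allOrbitsEven [Finite α] {σ : Perm α} {f : α → Bool}
    (h : σ.IsAlternating f) : σ.allOrbitsEven := by
  intro x
  have h1 := h.zpow_apply (σ.orbitSize x) x
  rw [(σ.orbitSize_dvd_iff x _).1 dvd_rfl] at h1
  by_contra h2
  simp [h2] at h1

theorem allOrbitsEven.exists_isAlternating [Finite α] {σ : Perm α} (h : σ.allOrbitsEven) :
    ∃ f : α → Bool, σ.IsAlternating f := by
  classical
  let rep (x : α) : α := Quotient.out (Quotient.mk (SameCycle.setoid σ) x)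
  have hrep (x : α) : σ.SameCycle (rep x) x := Quotient.mk_out (s := SameCycle.setoid σ) x
  choose n hn using hrep
  refine ⟨fun x => decide (Even (n x)), fun x => ?_⟩
  have hx : rep (σ x) = rep x :=
    congrArg Quotient.out (Quotient.sound (s := SameCycle.setoid σ)
      (show σ.SameCycle (σ x) x from sameCycle_apply_left.2 (SameCycle.refl σ x)))
  have h1 : (σ ^ (-(n x) + (-1 + n (σ x)))) (rep x) = rep x := by
    rw [zpow_add, zpow_add, mul_apply, mul_apply, ← hx, hn, hx, zpow_neg_one,
      show σ⁻¹ (σ x) = x from σ.symm_apply_apply x, zpow_neg, inv_eq_iff_eq]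
    exact (hn x).symm
  have h2 : Even (-(n x) + (-1 + n (σ x))) :=
    even_iff_two_dvd.2 (dvd_trans
      (by exact_mod_cast (h (rep x)).two_dvd) ((σ.orbitSize_dvd_iff _ _).2 h1))
  by_cases h3 : Even (n x) <;> by_cases h4 : Even (n (σ x)) <;>
    simp [h3, h4, Int.even_add, parity_simps] at h2 ⊢

/-- Functions on the orbits of `σ` correspond to alternating colourings, once one of the
latter is fixed. -/
noncomputable def IsAlternating.orbitColoringEquiv {σ : Perm α} {f : α → Bool}
    (h : σ.IsAlternating f) :
    (Quotient (SameCycle.setoid σ) → Bool) ≃ {g : α → Bool // σ.IsAlternating g} where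
  toFun c := ⟨fun x => (c (Quotient.mk _ x) ^^ f x), fun x => by
    have : Quotient.mk (SameCycle.setoid σ) (σ x) = Quotient.mk _ x :=
      Quotient.sound (s := SameCycle.setoid σ)
        (show σ.SameCycle (σ x) x from sameCycle_apply_left.2 (SameCycle.refl σ x))
    simp [this, h x]⟩
  invFun g q := Quotient.liftOn q (fun x => (g.1 x ^^ f x)) (by
    rintro x _ ⟨n, rfl⟩
    simp [g.2.zpow_apply, h.zpow_apply, Bool.xor_left_comm, Bool.xor_comm])
  left_inv c := by
    ext q
    induction q using Quotient.inductionOn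
    simp
  right_inv g := by
    ext x
    simp

open scoped Classical in
theorem card_isAlternating_coloring [Finite α] (σ : Perm α) :
    Nat.card {f : α → Bool // σ.IsAlternating f} =
      if σ.allOrbitsEven then 2 ^ σ.numCycles else 0 := by
  split_ifs with h
  · obtain ⟨f, hf⟩ := h.exists_isAlternating
    rw [← Nat.card_congr hf.orbitColoringEquiv, Nat.card_fun, numCycles]
    simp
  · rw [Nat.card_eq_zero]
    exact .inl ⟨fun f => h f.2.allOrbitsEven⟩

/-- The permutations along which `f` alternates form a coset of the stabilizer of `f`. -/
def IsAlternating.stabilizerEquiv {τ : Perm α} {f : α → Bool} (h : τ.IsAlternating f) :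
    {g : Perm α // f ∘ g = f} ≃ {σ : Perm α // σ.IsAlternating f} :=
  (Equiv.mulLeft τ).subtypeEquiv fun g => by
    simp [funext_iff, IsAlternating, h _]

theorem card_isAlternating [Fintype α] (f : α → Bool) :
    Nat.card {σ : Perm α // σ.IsAlternating f} =
      if 2 * #{x | f x = true} = Fintype.card α then (Nat.factorial #{x | f x = true}) ^ 2 else 0 := by
  classical
  have hsum : #{x | f x = true} + #{x | f x = false} = Fintype.card α := by
    simpa using card_filter_add_card_filter_not (s := (univ : Finset α)) (fun x => f x = true)
  split_ifs with h
  · have hft : #{x | f x = true} = #{x | f x = false} := by omega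
    have e (c : Bool) : Nonempty ({a // f a = c} ≃ {b // (!f b) = c}) := by
      rw [← Fintype.card_eq, Fintype.card_subtype, Fintype.card_subtype]
      cases c <;> simp [hft]
    let τ : Perm α := Equiv.ofFiberEquiv fun c => (e c).some
    have hτ : τ.IsAlternating f := fun x =>
      Bool.not_eq_eq_eq_not.1 (Equiv.ofFiberEquiv_map (g := fun b => !f b) _ x)
    rw [← Nat.card_congr hτ.stabilizerEquiv, Nat.card_eq_fintype_card,
      DomMulAct.stabilizer_card]
    simp [Fintype.card_subtype, hft, sq]
  · rw [Nat.card_eq_zero]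
    refine .inl ⟨fun ⟨σ, hσ⟩ => h ?_⟩
    have : #{x | f x = true} = #{x | f x = false} :=
      card_equiv σ fun x => by simp [hσ x]
    omega

end Equiv.Perm

theorem card_filter_card_true_eq {α : Type*} [Fintype α] [DecidableEq α] (m : ℕ) :
    #{f : α → Bool | #{x | f x = true} = m} = (Fintype.card α).choose m := by
  rw [← card_univ, ← card_powersetCard]
  refine card_nbij' (fun f => univ.filter fun x => f x = true) (fun s x => decide (x ∈ s)) ?_ ?_ ?_ ?_
  · intro f hf
    simpa [mem_powersetCard] using hf
  · intro s hs
    simpa [mem_powersetCard] using hs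
  · intro f _
    simp
  · intro s _
    simp

open scoped Classical in
/-- For `k ≥ 1`, the sum of `2 ^ c(σ)` over all permutations `σ` of a `k`-element set
all of whose orbits have even size equals `k!` if `k` is even and `0` if `k` is odd. -/
theorem sum_two_pow_numCycles_even_orbits (k : ℕ) (hk : 1 ≤ k) :
    ∑ σ : Equiv.Perm (Fin k), (if σ.allOrbitsEven then 2 ^ σ.numCycles else 0) =
      if Even k then Nat.factorial k else 0 := by
  calc ∑ σ : Equiv.Perm (Fin k), (if σ.allOrbitsEven then 2 ^ σ.numCycles else 0)
      = ∑ σ : Equiv.Perm (Fin k), #{f : Fin k → Bool | σ.IsAlternating f} := by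
        refine sum_congr rfl fun σ _ => ?_
        rw [← σ.card_isAlternating_coloring, Nat.card_eq_fintype_card, Fintype.card_subtype]
    _ = ∑ f : Fin k → Bool, #{σ : Equiv.Perm (Fin k) | σ.IsAlternating f} :=
        sum_card_bipartiteAbove_eq_sum_card_bipartiteBelow _
    _ = ∑ f : Fin k → Bool,
          if 2 * #{x | f x = true} = k then (Nat.factorial #{x | f x = true}) ^ 2 else 0 := by
        refine sum_congr rfl fun f _ => ?_
        rw [← Fintype.card_subtype, ← Nat.card_eq_fintype_card, Equiv.Perm.card_isAlternating,
          Fintype.card_fin]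
    _ = if Even k then Nat.factorial k else 0 := by
        split_ifs with h
        · obtain ⟨m, rfl⟩ := h
          have hm (f : Fin (m + m) → Bool) :
              (if 2 * #{x | f x = true} = m + m then (Nat.factorial #{x | f x = true}) ^ 2
                else 0) = if #{x | f x = true} = m then (Nat.factorial m) ^ 2 else 0 := by
            by_cases hf : #{x | f x = true} = m
            · simp [hf, two_mul]
            · rw [if_neg (by omega), if_neg hf]
          simp_rw [hm]
          rw [← sum_filter, sum_const, card_filter_card_true_eq, Fintype.card_fin, smul_eq_mul,
            ← Nat.add_choose_mul_factorial_mul_factorial m m, sq, mul_assoc]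
        · refine sum_eq_zero fun f _ => if_neg fun hf => h ?_
          exact hf ▸ even_two_mul _
end

section
/- Let n ≥ 1 and let σ be a permutation of the set {1,…,n}. Then the number of subsets A of {1,…,n} with σ(A) = A^c (the complement of A) equals 2^{c(σ)} if every orbit of σ has even size, and equals 0 otherwise. -/
open Equiv Finset

theorem Equiv.Perm.orbitSize_eq_minimalPeriod {α : Type*} [Finite α] (σ : Equiv.Perm α) (x : α) :
    σ.orbitSize x = Function.minimalPeriod (σ • ·) x := by
  classical
  have := Fintype.ofFinite α
  rw [MulAction.minimalPeriod_eq_card, Equiv.Perm.orbitSize, ← Nat.card_eq_fintype_card]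
  refine Nat.card_congr (Equiv.subtypeEquivRight fun y => ?_)
  simp [MulAction.mem_orbit_iff, Equiv.Perm.SameCycle, Subgroup.smul_def]

theorem Equiv.Perm.zpow_apply_eq_self_iff_orbitSize_dvd {α : Type*} [Finite α]
    (σ : Equiv.Perm α) (x : α) (k : ℤ) : (σ ^ k) x = x ↔ (σ.orbitSize x : ℤ) ∣ k := by
  rw [σ.orbitSize_eq_minimalPeriod, ← MulAction.zpow_smul_eq_iff_minimalPeriod_dvd,
    Equiv.Perm.smul_def]

theorem Finset.image_perm_eq_compl_iff {α : Type*} [Fintype α] [DecidableEq α]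
    (σ : Equiv.Perm α) (A : Finset α) :
    A.image ⇑σ = Aᶜ ↔ ∀ x, σ x ∈ A ↔ x ∉ A := by
  rw [Finset.ext_iff, σ.surjective.forall]
  refine forall_congr' fun x => ?_
  rw [σ.injective.mem_finset_image, mem_compl]
  tauto

theorem Equiv.Perm.zpow_apply_mem_iff {α : Type*} {σ : Equiv.Perm α} {A : Finset α}
    (hA : ∀ x, σ x ∈ A ↔ x ∉ A) (x : α) (k : ℤ) : (σ ^ k) x ∈ A ↔ (x ∈ A ↔ Even k) := by
  have step (k : ℤ) : (σ ^ (k + 1)) x ∈ A ↔ (σ ^ k) x ∉ A := by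
    rw [add_comm, zpow_one_add, Equiv.Perm.mul_apply, hA]
  induction k with
  | zero => simp
  | succ i ih =>
    have h := step i
    have he := Int.even_add_one (n := (i : ℤ))
    tauto
  | pred i ih =>
    have h := step (-(i : ℤ) - 1)
    have he := Int.even_add_one (n := -(i : ℤ) - 1)
    rw [sub_add_cancel] at h he
    tauto

theorem Equiv.Perm.allOrbitsEven_of_apply_mem_iff {α : Type*} [Finite α] {σ : Equiv.Perm α}
    {A : Finset α} (hA : ∀ x, σ x ∈ A ↔ x ∉ A) : σ.allOrbitsEven := by
  intro x
  have h := zpow_apply_mem_iff hA x (σ.orbitSize x)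
  rw [(σ.zpow_apply_eq_self_iff_orbitSize_dvd x _).2 dvd_rfl, Int.even_coe_nat] at h
  tauto

/-- `y` is obtained from the chosen representative of its orbit by an even power of `σ`. -/
def Equiv.Perm.IsEvenFromOut {α : Type*} (σ : Equiv.Perm α) (y : α) : Prop :=
  ∃ k : ℤ, Even k ∧ (σ ^ k) (Quotient.mk (SameCycle.setoid σ) y).out = y

theorem Equiv.Perm.mk_apply_eq {α : Type*} (σ : Equiv.Perm α) (y : α) :
    Quotient.mk (SameCycle.setoid σ) (σ y) = Quotient.mk (SameCycle.setoid σ) y :=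
  Quotient.sound (sameCycle_apply_left.2 (SameCycle.refl σ y))

theorem Equiv.Perm.exists_zpow_out_eq {α : Type*} (σ : Equiv.Perm α) (y : α) :
    ∃ k : ℤ, (σ ^ k) (Quotient.mk (SameCycle.setoid σ) y).out = y :=
  Quotient.mk_out (s := SameCycle.setoid σ) y

theorem Equiv.Perm.isEvenFromOut_out {α : Type*} (σ : Equiv.Perm α)
    (q : Quotient (SameCycle.setoid σ)) : σ.IsEvenFromOut q.out :=
  ⟨0, Even.zero, by simp⟩

theorem Equiv.Perm.allOrbitsEven.isEvenFromOut_apply_iff {α : Type*} [Finite α]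
    {σ : Equiv.Perm α} (hσ : σ.allOrbitsEven) (y : α) :
    σ.IsEvenFromOut (σ y) ↔ ¬ σ.IsEvenFromOut y := by
  unfold IsEvenFromOut
  rw [σ.mk_apply_eq]
  obtain ⟨m, hm⟩ := σ.exists_zpow_out_eq y
  generalize (Quotient.mk (SameCycle.setoid σ) y).out = o at *
  have hm' : (σ ^ (m + 1)) o = σ y := by
    rw [add_comm, zpow_one_add, mul_apply, hm]
  have parity {k l : ℤ} (h : (σ ^ k) o = (σ ^ l) o) : Even k ↔ Even l := by
    have hd : (σ ^ (-l + k)) o = o := by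
      rw [zpow_add, mul_apply, h, ← mul_apply, ← zpow_add, neg_add_cancel, zpow_zero, one_apply]
    have he : Even (-l + k) := (((Int.even_coe_nat _).2 (hσ o)).trans_dvd
      ((σ.zpow_apply_eq_self_iff_orbitSize_dvd o _).1 hd))
    rw [Int.even_add, even_neg] at he
    exact he.symm
  have key {k : ℤ} {z : α} (h : (σ ^ k) o = z) :
      (∃ l : ℤ, Even l ∧ (σ ^ l) o = z) ↔ Even k :=
    ⟨fun ⟨_, hl, hz⟩ => (parity (hz.trans h.symm)).1 hl, fun hk => ⟨k, hk, h⟩⟩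
  rw [key hm, key hm', Int.even_add_one]

open scoped Classical in
theorem Equiv.Perm.allOrbitsEven.card_filter_apply_mem_iff {α : Type*} [Fintype α]
    {σ : Equiv.Perm α} (hσ : σ.allOrbitsEven) :
    ((Finset.univ : Finset (Finset α)).filter fun A => ∀ x, σ x ∈ A ↔ x ∉ A).card =
      2 ^ σ.numCycles := by
  have hcard : Nat.card (Quotient (SameCycle.setoid σ) → Prop) = 2 ^ σ.numCycles := by
    rw [Nat.card_fun, Nat.card_eq_fintype_card, Fintype.card_prop, numCycles]
  rw [← hcard, ← Fintype.card_subtype, ← Nat.card_eq_fintype_card]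
  refine Nat.card_eq_of_bijective (fun A q => q.out ∈ A.1) ⟨?_, fun f => ?_⟩
  · rintro ⟨A, hA⟩ ⟨B, hB⟩ h
    ext y
    obtain ⟨k, hk⟩ := σ.exists_zpow_out_eq y
    have hy := congrFun h (Quotient.mk _ y)
    rw [← hk, zpow_apply_mem_iff hA, zpow_apply_mem_iff hB]
    exact iff_congr hy.to_iff Iff.rfl
  · refine ⟨⟨Finset.univ.filter fun y => f (Quotient.mk _ y) ↔ σ.IsEvenFromOut y,
      fun x => ?_⟩, funext fun q => ?_⟩
    · have := hσ.isEvenFromOut_apply_iff x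
      simp only [mem_filter, mem_univ, true_and, σ.mk_apply_eq]
      tauto
    · simp [σ.isEvenFromOut_out q]

open scoped Classical in
/-- For `n ≥ 1` and a permutation `σ` of an `n`-element set, the number of subsets
`A` with `σ(A) = Aᶜ` equals `2 ^ c(σ)` if every orbit of `σ` has even size and `0`
otherwise. -/
theorem count_complementing_subsets (n : ℕ) (hn : 1 ≤ n) (σ : Equiv.Perm (Fin n)) :
    ((Finset.univ : Finset (Finset (Fin n))).filter fun A => A.image ⇑σ = Aᶜ).card =
      if σ.allOrbitsEven then 2 ^ σ.numCycles else 0 := by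
  simp only [image_perm_eq_compl_iff]
  split_ifs with hσ
  · convert hσ.card_filter_apply_mem_iff
  · exact card_eq_zero.2 (filter_eq_empty_iff.2 fun A _ hA =>
      hσ (Equiv.Perm.allOrbitsEven_of_apply_mem_iff hA))
end

section
/- Let n ≥ 3 and let σ be a permutation of the set {1,…,n}. Consider all unordered partitions {A, B} of {1,…,n} into two subsets with |A| ≥ 2 and |B| ≥ 2 (so B = A^c). The number of such partitions fixed by σ, i.e. with {σ(A), σ(B)} = {A, B}, equals 2^{c(σ)−1} − 1 − n_1(σ) + δ(σ), where δ(σ) = 2^{c(σ)−1} if every orbit of σ has even size and δ(σ) = 0 otherwise. -/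
open Equiv Finset

namespace Equiv.Perm

variable {α : Type*}

theorem zpow_apply_eq_self_iff_orbitSize_dvd_s5 [Finite α] (σ : Equiv.Perm α) (x : α) (m : ℤ) :
    (σ ^ m) x = x ↔ (σ.orbitSize x : ℤ) ∣ m := by
  have h : σ.orbitSize x = Function.minimalPeriod (σ • ·) x := by
    classical
    have := Fintype.ofFinite α
    have := Fintype.ofFinite (MulAction.orbit (Subgroup.zpowers σ) x)
    rw [MulAction.minimalPeriod_eq_card, ← Nat.card_eq_fintype_card]
    refine Nat.card_congr (Equiv.subtypeEquivRight fun _ => ?_)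
    constructor
    · rintro ⟨i, rfl⟩
      exact ⟨⟨σ ^ i, i, rfl⟩, rfl⟩
    · rintro ⟨⟨_, i, rfl⟩, rfl⟩
      exact ⟨i, rfl⟩
  rw [h, ← MulAction.zpow_smul_eq_iff_minimalPeriod_dvd, Equiv.Perm.smul_def]

theorem orbitSize_eq_one_iff [Finite α] (σ : Equiv.Perm α) (x : α) :
    σ.orbitSize x = 1 ↔ σ x = x := by
  have h := zpow_apply_eq_self_iff_orbitSize_dvd_s5 σ x 1
  rw [zpow_one] at h
  rw [h, ← Nat.dvd_one]
  norm_cast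

theorem numOrbits_one [Fintype α] [DecidableEq α] (σ : Equiv.Perm α) :
    σ.numOrbits 1 = #{x | σ x = x} := by
  rw [← Fintype.card_subtype, ← Nat.card_eq_fintype_card]
  symm
  refine Nat.card_congr (Equiv.ofBijective
    (fun x => ⟨Quotient.mk _ x.1, (orbitSize_eq_one_iff σ x.1).2 x.2⟩) ⟨?_, ?_⟩)
  · rintro ⟨x, hx⟩ ⟨y, hy⟩ hxy
    obtain ⟨i, hi⟩ : σ.SameCycle x y := Quotient.exact (Subtype.ext_iff.1 hxy)
    rw [zpow_apply_eq_self_of_apply_eq_self hx] at hi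
    exact Subtype.ext hi
  · rintro ⟨ω, hω⟩
    induction ω using Quotient.inductionOn with
    | h x => exact ⟨⟨x, (orbitSize_eq_one_iff σ x).1 hω⟩, rfl⟩

theorem image_eq_iff_forall [DecidableEq α] (σ : Equiv.Perm α) (A B : Finset α) :
    A.image σ = B ↔ ∀ x, σ x ∈ B ↔ x ∈ A := by
  constructor
  · rintro rfl x
    simp
  · intro h
    ext y
    obtain ⟨x, rfl⟩ := σ.surjective y
    simp [h]

theorem card_invariant_finsets [Fintype α] [DecidableEq α] (σ : Equiv.Perm α) :
    #{A : Finset α | A.image σ = A} = 2 ^ σ.numCycles := by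
  classical
  have hcard : 2 ^ σ.numCycles = Nat.card (Set (Quotient (SameCycle.setoid σ))) := by
    rw [numCycles, Nat.card_eq_fintype_card, Nat.card_eq_fintype_card, Fintype.card_set]
  rw [hcard, ← Fintype.card_subtype, ← Nat.card_eq_fintype_card]
  symm
  refine Nat.card_congr (Equiv.ofBijective
    (fun s => ⟨Finset.univ.filter fun x => Quotient.mk (SameCycle.setoid σ) x ∈ s, ?_⟩) ⟨?_, ?_⟩)
  · rw [image_eq_iff_forall]
    intro x
    have : Quotient.mk (SameCycle.setoid σ) (σ x) = Quotient.mk _ x :=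
      Quotient.sound (sameCycle_apply_left.2 (SameCycle.refl σ x))
    simp [this]
  · intro s t hst
    ext ω
    induction ω using Quotient.inductionOn with
    | h x => simpa using Finset.ext_iff.1 (Subtype.ext_iff.1 hst) x
  · rintro ⟨A, hA⟩
    rw [image_eq_iff_forall] at hA
    have hmem : ∀ (i : ℤ) x, (σ ^ i) x ∈ A ↔ x ∈ A := by
      intro i
      induction i with
      | zero => simp
      | succ i ih => intro x; rw [zpow_add_one, Perm.mul_apply, ih, hA]
      | pred i ih =>
        intro x
        rw [zpow_sub_one, Perm.mul_apply, ih, ← hA, ← Perm.mul_apply, mul_inv_cancel, Perm.one_apply]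
    refine ⟨Quotient.mk _ '' (A : Set α), Subtype.ext ?_⟩
    ext x
    simp only [Finset.mem_filter, Finset.mem_univ, true_and, Set.mem_image, Finset.mem_coe]
    constructor
    · rintro ⟨y, hy, hyx⟩
      obtain ⟨i, rfl⟩ : σ.SameCycle y x := Quotient.exact hyx
      exact (hmem i y).2 hy
    · exact fun hx => ⟨x, hx, rfl⟩

theorem exists_image_eq_compl_iff [Fintype α] [DecidableEq α] (σ : Equiv.Perm α) :
    (∃ A : Finset α, A.image σ = Aᶜ) ↔ σ.allOrbitsEven := by
  classical
  simp only [image_eq_iff_forall, Finset.mem_compl]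
  constructor
  · rintro ⟨A, hA⟩ x
    have hmem : ∀ i : ℕ, (σ ^ i) x ∈ A ↔ (Even i ↔ x ∈ A) := by
      intro i
      induction i with
      | zero => simp
      | succ i ih =>
        have := hA ((σ ^ i) x)
        rw [pow_succ', Perm.mul_apply, Nat.even_add_one]
        tauto
    have h := hmem (σ.orbitSize x)
    have hx := (zpow_apply_eq_self_iff_orbitSize_dvd_s5 σ x _).2 dvd_rfl
    rw [zpow_natCast] at hx
    rw [hx] at h
    tauto
  · intro hσ
    have heven : ∀ x (m : ℤ), (σ ^ m) x = x → Even m := by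
      intro x m h
      rw [zpow_apply_eq_self_iff_orbitSize_dvd_s5] at h
      exact even_iff_two_dvd.2 (dvd_trans (by exact_mod_cast (hσ x).two_dvd) h)
    let rep : α → α := fun x => (Quotient.mk (SameCycle.setoid σ) x).out
    have hrep : ∀ x, σ.SameCycle (rep x) x := fun x =>
      Quotient.exact (Quotient.out_eq (Quotient.mk (SameCycle.setoid σ) x))
    have hrepσ : ∀ x, rep (σ x) = rep x := fun x =>
      congrArg Quotient.out (Quotient.sound (sameCycle_apply_left.2 (SameCycle.refl σ x)))
    refine ⟨Finset.univ.filter fun x => ∃ m : ℤ, Even m ∧ (σ ^ m) (rep x) = x, fun x => ?_⟩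
    simp only [Finset.mem_filter, Finset.mem_univ, true_and, hrepσ]
    constructor
    · intro h
      obtain ⟨m, hm⟩ := hrep x
      refine ⟨m, ?_, hm⟩
      by_contra hodd
      refine h ⟨1 + m, ?_, ?_⟩
      · rw [Int.even_add]; simp [hodd]
      · rw [zpow_one_add, Perm.mul_apply, hm]
    · rintro ⟨m, hm, hmx⟩ ⟨l, hl, hlx⟩
      have h : (σ ^ (-l + (1 + m))) (rep x) = rep x := by
        rw [zpow_add, zpow_one_add, Perm.mul_apply, Perm.mul_apply, hmx, ← hlx, ← Perm.mul_apply,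
          ← zpow_add]
        simp
      have := heven _ _ h
      simp [Int.even_add, hl, hm] at this

open scoped Classical in
theorem card_image_eq_compl [Fintype α] [DecidableEq α] (σ : Equiv.Perm α) :
    #{A : Finset α | A.image σ = Aᶜ} = if σ.allOrbitsEven then 2 ^ σ.numCycles else 0 := by
  split_ifs with h
  · obtain ⟨B, hB⟩ := (exists_image_eq_compl_iff σ).2 h
    rw [← card_invariant_finsets]
    rw [image_eq_iff_forall] at hB
    refine Finset.card_nbij' (symmDiff B) (symmDiff B) ?_ ?_ ?_ ?_
    · intro A hA
      simp only [Finset.coe_filter, Finset.mem_univ, true_and, Set.mem_ofPred_eq,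
        image_eq_iff_forall] at hA ⊢
      intro x
      have := hA x
      have := hB x
      simp only [Finset.mem_symmDiff, Finset.mem_compl] at *
      tauto
    · intro A hA
      simp only [Finset.coe_filter, Finset.mem_univ, true_and, Set.mem_ofPred_eq,
        image_eq_iff_forall] at hA ⊢
      intro x
      have := hA x
      have := hB x
      simp only [Finset.mem_symmDiff, Finset.mem_compl] at *
      tauto
    · intro A _
      simp
    · intro A _
      simp
  · rw [Finset.card_eq_zero, Finset.filter_eq_empty_iff]
    exact fun A _ hA => h ((exists_image_eq_compl_iff σ).1 ⟨A, hA⟩)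

theorem one_le_numCycles [Finite α] [Nonempty α] (σ : Equiv.Perm α) : 1 ≤ σ.numCycles :=
  have : Nonempty (Quotient (SameCycle.setoid σ)) := ‹Nonempty α›.map (Quotient.mk _)
  Nat.card_pos

theorem image_compl [Fintype α] [DecidableEq α] (σ : Equiv.Perm α) (A : Finset α) :
    Aᶜ.image σ = (A.image σ)ᶜ :=
  Finset.coe_injective (by push_cast; exact Set.image_compl_eq σ.bijective)

/-- `A` is one side of an unordered bipartition `{A, Aᶜ}` fixed by `σ`. -/
def FixesSplit [Fintype α] [DecidableEq α] (σ : Equiv.Perm α) (A : Finset α) : Prop :=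
  A.image σ = A ∨ A.image σ = Aᶜ

theorem fixesSplit_compl [Fintype α] [DecidableEq α] (σ : Equiv.Perm α) (A : Finset α) :
    σ.FixesSplit Aᶜ ↔ σ.FixesSplit A := by
  simp only [FixesSplit, image_compl, compl_inj_iff]

theorem image_pair_eq_iff [Fintype α] [DecidableEq α] (σ : Equiv.Perm α) (A : Finset α) :
    ({A, Aᶜ} : Finset (Finset α)).image (fun A => A.image σ) = {A, Aᶜ} ↔ σ.FixesSplit A := by
  rw [Finset.image_insert, Finset.image_singleton, image_compl]
  constructor
  · intro h
    have : A.image σ ∈ ({A, Aᶜ} : Finset (Finset α)) := h ▸ Finset.mem_insert_self _ _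
    simpa [FixesSplit] using this
  · rintro (h | h)
    · rw [h]
    · rw [h, compl_compl, Finset.pair_comm]

open scoped Classical in
theorem card_fixesSplit [Fintype α] [DecidableEq α] [Nonempty α] (σ : Equiv.Perm α) :
    #{A : Finset α | σ.FixesSplit A} =
      2 ^ σ.numCycles + if σ.allOrbitsEven then 2 ^ σ.numCycles else 0 := by
  rw [← card_image_eq_compl, ← card_invariant_finsets, ← Finset.card_union_of_disjoint]
  · rw [← Finset.filter_or]
    congr 1
    ext A
    rw [Finset.mem_filter, Finset.mem_filter, FixesSplit]
  · rw [Finset.disjoint_filter]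
    intro A _ h h'
    exact (ne_compl_self (a := A)) (h.symm.trans h')

open scoped Classical in
theorem card_fixesSplit_card_le_one [Fintype α] [DecidableEq α] (hα : 3 ≤ Fintype.card α) (σ : Equiv.Perm α) :
    #{A : Finset α | σ.FixesSplit A ∧ #A ≤ 1} = 1 + σ.numOrbits 1 := by
  have h : ({A : Finset α | σ.FixesSplit A ∧ #A ≤ 1} : Finset (Finset α)) =
      insert ∅ (({x | σ x = x} : Finset α).image singleton) := by
    ext A
    simp only [Finset.mem_filter, Finset.mem_univ, true_and, Finset.mem_insert, Finset.mem_image]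
    constructor
    · rintro ⟨hA, hcard⟩
      have : Nonempty α := Fintype.card_pos_iff.1 (by omega)
      obtain ⟨x, hx⟩ := Finset.card_le_one_iff_subset_singleton.1 hcard
      rcases Finset.subset_singleton_iff.1 hx with rfl | rfl
      · exact Or.inl rfl
      · refine Or.inr ⟨x, ?_, rfl⟩
        rcases hA with hA | hA
        · simpa using hA
        · have := congrArg Finset.card hA
          rw [Finset.card_compl] at this
          simp at this
          omega
    · rintro (rfl | ⟨x, hx, rfl⟩)
      · simp [FixesSplit]
      · simp [FixesSplit, hx]
  rw [h, Finset.card_insert_of_notMem (by simp),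
    Finset.card_image_of_injective _ Finset.singleton_injective, numOrbits_one, add_comm]

open scoped Classical in
theorem card_fixesSplit_small [Fintype α] [DecidableEq α] (hα : 3 ≤ Fintype.card α) (σ : Equiv.Perm α) :
    #{A : Finset α | σ.FixesSplit A ∧ ¬ (2 ≤ #A ∧ 2 ≤ #Aᶜ)} = 2 * (1 + σ.numOrbits 1) := by
  have h : #{A : Finset α | σ.FixesSplit A ∧ #Aᶜ ≤ 1} = 1 + σ.numOrbits 1 := by
    rw [← card_fixesSplit_card_le_one hα]
    refine Finset.card_nbij' compl compl ?_ ?_ ?_ ?_ <;> intro A <;>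
      simp +contextual [fixesSplit_compl]
  rw [two_mul]
  nth_rewrite 1 [← card_fixesSplit_card_le_one hα]
  rw [← h, ← Finset.card_union_of_disjoint]
  · congr 1
    ext A
    simp only [Finset.mem_filter, Finset.mem_univ, true_and, Finset.mem_union, ← and_or_left]
    refine and_congr_right fun _ => ?_
    omega
  · rw [Finset.disjoint_filter]
    rintro A _ ⟨_, h1⟩ ⟨_, h2⟩
    have := Finset.card_add_card_compl A
    omega

open scoped Classical in
theorem two_mul_card_pairs [Fintype α] [DecidableEq α] [Nonempty α] (p : Finset α → Prop)
    (hp : ∀ A, p Aᶜ ↔ p A) :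
    2 * #(({A | p A} : Finset (Finset α)).image fun A => ({A, Aᶜ} : Finset (Finset α))) =
      #{A : Finset α | p A} := by
  rw [Finset.card_eq_sum_card_image (fun A => ({A, Aᶜ} : Finset (Finset α))),
    Finset.sum_const_nat (m := 2), mul_comm]
  intro S hS
  obtain ⟨A, hA, rfl⟩ := Finset.mem_image.1 hS
  rw [← Finset.card_pair (ne_compl_self (a := A))]
  congr 1
  ext B
  simp only [Finset.mem_filter, Finset.mem_univ, true_and, Finset.mem_insert,
    Finset.mem_singleton] at hA ⊢
  constructor
  · rintro ⟨_, h⟩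
    have : B ∈ ({A, Aᶜ} : Finset (Finset α)) := h ▸ Finset.mem_insert_self _ _
    simpa using this
  · rintro (rfl | rfl)
    · exact ⟨hA, rfl⟩
    · exact ⟨(hp A).2 hA, by rw [compl_compl, Finset.pair_comm]⟩

end Equiv.Perm

open scoped Classical in
/-- For `n ≥ 3` and a permutation `σ` of an `n`-element set, the number of unordered
partitions `{A, B}` of the set into two parts of size at least `2` (so `B = Aᶜ`,
encoded as the two-element set `{A, Aᶜ}`) fixed by `σ`, i.e. with
`{σ(A), σ(B)} = {A, B}`, equals `2 ^ (c(σ) - 1) - 1 - n₁(σ) + δ(σ)`, where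
`δ(σ) = 2 ^ (c(σ) - 1)` if every orbit of `σ` has even size and `δ(σ) = 0` otherwise. -/
theorem count_invariant_partitions (n : ℕ) (hn : 3 ≤ n) (σ : Equiv.Perm (Fin n)) :
    (((Finset.univ : Finset (Finset (Finset (Fin n)))).filter fun S =>
        (∃ A : Finset (Fin n), S = {A, Aᶜ} ∧ 2 ≤ A.card ∧ 2 ≤ Aᶜ.card) ∧
          S.image (fun A => A.image ⇑σ) = S).card : ℤ) =
      2 ^ (σ.numCycles - 1) - 1 - σ.numOrbits 1 +
        (if σ.allOrbitsEven then (2 : ℤ) ^ (σ.numCycles - 1) else 0) := by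
  have : Nonempty (Fin n) := ⟨⟨0, by omega⟩⟩
  let p : Finset (Fin n) → Prop := fun A => σ.FixesSplit A ∧ (2 ≤ #A ∧ 2 ≤ #Aᶜ)
  have hp : ∀ A, p Aᶜ ↔ p A := fun A => by
    simp only [p, Equiv.Perm.fixesSplit_compl, compl_compl, and_comm]
  have hpairs := Equiv.Perm.two_mul_card_pairs p hp
  have hsplit := Finset.card_filter_add_card_filter_not
    (s := ({A | σ.FixesSplit A} : Finset (Finset (Fin n)))) (fun A => 2 ≤ #A ∧ 2 ≤ #Aᶜ)
  have hsmall := Equiv.Perm.card_fixesSplit_small (by simpa using hn) σ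
  have htotal := Equiv.Perm.card_fixesSplit σ
  rw [Finset.filter_filter, Finset.filter_filter] at hsplit
  have hS : ((Finset.univ : Finset (Finset (Finset (Fin n)))).filter fun S =>
        (∃ A : Finset (Fin n), S = {A, Aᶜ} ∧ 2 ≤ A.card ∧ 2 ≤ Aᶜ.card) ∧
          S.image (fun A => A.image ⇑σ) = S) =
      ({A | p A} : Finset (Finset (Fin n))).image fun A => {A, Aᶜ} := by
    ext S
    simp only [Finset.mem_filter, Finset.mem_univ, true_and, Finset.mem_image, p]
    constructor
    · rintro ⟨⟨A, rfl, hA⟩, h⟩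
      exact ⟨A, ⟨(Equiv.Perm.image_pair_eq_iff σ A).1 h, hA⟩, rfl⟩
    · rintro ⟨A, ⟨h, hA⟩, rfl⟩
      exact ⟨⟨A, rfl, hA⟩, (Equiv.Perm.image_pair_eq_iff σ A).2 h⟩
  rw [hS]
  obtain ⟨k, hk⟩ := Nat.exists_eq_add_of_le' σ.one_le_numCycles
  rw [hk, pow_succ] at htotal
  rw [hk, Nat.add_sub_cancel]
  have hcount : #(({A | p A} : Finset (Finset (Fin n))).image fun A => ({A, Aᶜ} : Finset _)) +
      1 + σ.numOrbits 1 = 2 ^ k + if σ.allOrbitsEven then 2 ^ k else 0 := by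
    simp only [p] at hpairs ⊢
    split_ifs at htotal ⊢ <;> omega
  zify at hcount
  linarith
end

section
/- Let n ≥ 1, l ≥ 1, and let a_1, …, a_l be positive integers; let 𝔞 denote the number of indices i with a_i = 1. Then, as an identity of integers, the sum over all tuples (σ_1, …, σ_l) in S_{a_1} × ⋯ × S_{a_l} of the quantity 2^{n − 1 + c(σ_1) + ⋯ + c(σ_l)} − 1 − (n_2(σ_1) + ⋯ + n_2(σ_l)) − binom(n + n_1(σ_1) + ⋯ + n_1(σ_l), 2) equals a_1!⋯a_l! · ( 2^{n−1}(a_1+1)⋯(a_l+1) − 1 − (l − 𝔞) − binom(n,2) − n·l − binom(l,2) ). -/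
open Equiv Finset

theorem sum_ite_eq_const {α : Type*} [Fintype α] [DecidableEq α] (c d : ℕ) :
    (∑ x : α, ∑ y : α, if x = y then c else d) =
      Fintype.card α * (c + (Fintype.card α - 1) * d) := by
  have h : ∀ x : α, (∑ y : α, if x = y then c else d) = c + (Fintype.card α - 1) * d := by
    intro x
    rw [← add_sum_erase _ _ (mem_univ x), if_pos rfl,
      sum_congr rfl fun y hy => if_neg (ne_of_mem_erase hy).symm]
    simp
  simp [h]

theorem mul_pred_mul_factorial_sub_two {n : ℕ} (hn : n ≠ 0) :
    n * ((n - 1) * (n - 2).factorial) = n.factorial * (if n = 1 then 0 else 1) := by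
  obtain _ | _ | n := n
  · contradiction
  · simp
  · simp [Nat.factorial_succ]

theorem two_mul_choose_two (m : ℕ) : 2 * (m.choose 2 : ℤ) = m * (m - 1) := by
  induction m with
  | zero => simp
  | succ m ih =>
    rw [Nat.choose_succ_succ' m 1, Nat.choose_one_right]
    push_cast
    linarith

namespace Equiv.Perm

variable {α : Type*}

theorem orbitSize_eq_minimalPeriod_s6 [Finite α] (σ : Perm α) (x : α) :
    σ.orbitSize x = Function.minimalPeriod σ x := by
  classical
  have := Fintype.ofFinite (MulAction.orbit (Subgroup.zpowers σ) x)
  have h := MulAction.minimalPeriod_eq_card σ x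
  rw [← Nat.card_eq_fintype_card] at h
  refine Eq.trans ?_ h.symm
  refine Nat.card_congr (Equiv.subtypeEquivRight fun y => ?_)
  simp only [MulAction.mem_orbit_iff, SameCycle]
  constructor
  · rintro ⟨i, hi⟩
    exact ⟨⟨σ ^ i, i, rfl⟩, hi⟩
  · rintro ⟨⟨_, i, rfl⟩, hi⟩
    exact ⟨i, hi⟩

/-- The orbits of size `j` cover `j` points each. -/
theorem card_orbitSize_eq [Finite α] (σ : Perm α) (j : ℕ) :
    Nat.card {x // σ.orbitSize x = j} = j * σ.numOrbits j := by
  classical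
  have := Fintype.ofFinite α
  let Ω := {ω : Quotient (SameCycle.setoid σ) //
    Quotient.liftOn ω σ.orbitSize (fun _ _ h => σ.orbitSize_congr h) = j}
  let f : {x // σ.orbitSize x = j} → Ω := fun x => ⟨Quotient.mk _ x.1, x.2⟩
  have hfib : ∀ ω : Ω, Nat.card {x // f x = ω} = j := by
    rintro ⟨ω, hω⟩
    induction ω using Quotient.inductionOn with | _ y => ?_
    change σ.orbitSize y = j at hω
    conv_rhs => rw [← hω]
    refine Nat.card_congr ⟨fun x => ⟨x.1.1, ?_⟩, fun x => ⟨⟨x.1, ?_⟩, ?_⟩, ?_, ?_⟩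
    · exact (Quotient.exact (congrArg Subtype.val x.2)).symm
    · rw [← hω]; exact (σ.orbitSize_congr x.2).symm
    · exact Subtype.ext (Quotient.sound x.2.symm)
    · intro x; rfl
    · intro x; rfl
  have := Fintype.ofFinite Ω
  rw [← Nat.card_congr (Equiv.sigmaFiberEquiv f), Nat.card_sigma]
  simp only [hfib, sum_const, card_univ, smul_eq_mul, numOrbits]
  rw [← Nat.card_eq_fintype_card, mul_comm]

variable [Fintype α] [DecidableEq α]

theorem numOrbits_one_s6 (σ : Perm α) : σ.numOrbits 1 = ∑ x, if σ x = x then 1 else 0 := by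
  have h := σ.card_orbitSize_eq 1
  rw [one_mul] at h
  rw [← h, ← card_filter, ← Fintype.card_subtype, ← Nat.card_eq_fintype_card]
  refine Nat.card_congr (Equiv.subtypeEquivRight fun x => ?_)
  rw [orbitSize_eq_minimalPeriod_s6, Function.minimalPeriod_eq_one_iff_isFixedPt]
  rfl

theorem two_mul_numOrbits_two (σ : Perm α) :
    2 * σ.numOrbits 2 = ∑ x, ∑ y, if x ≠ y ∧ σ x = y ∧ σ y = x then 1 else 0 := by
  have hx : ∀ x, (∑ y, if x ≠ y ∧ σ x = y ∧ σ y = x then 1 else 0) =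
      if σ (σ x) = x ∧ σ x ≠ x then 1 else 0 := by
    intro x
    rw [sum_eq_single (σ x)]
    · exact if_congr (by tauto) rfl rfl
    · intro y _ hy
      exact if_neg fun h => hy h.2.1.symm
    · simp
  rw [← card_orbitSize_eq, sum_congr rfl fun x _ => hx x, ← card_filter,
    ← Fintype.card_subtype, ← Nat.card_eq_fintype_card]
  refine Nat.card_congr (Equiv.subtypeEquivRight fun x => ?_)
  rw [orbitSize_eq_minimalPeriod_s6, Function.minimalPeriod_eq_prime_iff]
  rfl

theorem card_fixing (s : Finset α) :
    #{σ : Perm α | ∀ x ∈ s, σ x = x} = (Fintype.card α - #s).factorial := by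
  have h := Fintype.card_congr (Perm.subtypeEquivSubtypePerm fun x => x ∉ s)
  rw [Fintype.card_perm, Fintype.card_subtype_compl, Fintype.card_coe,
    Fintype.card_subtype] at h
  simpa using h.symm

theorem card_fixing_one (x : α) :
    #{σ : Perm α | σ x = x} = (Fintype.card α - 1).factorial := by
  simpa using card_fixing {x}

theorem card_fixing_pair {x y : α} (h : x ≠ y) :
    #{σ : Perm α | σ x = x ∧ σ y = y} = (Fintype.card α - 2).factorial := by
  simpa [h] using card_fixing {x, y}

theorem card_swapping_pair {x y : α} (h : x ≠ y) :
    #{σ : Perm α | σ x = y ∧ σ y = x} = (Fintype.card α - 2).factorial := by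
  rw [← card_fixing_pair h]
  refine card_equiv (Equiv.mulLeft (swap x y)) fun σ => ?_
  simp [swap_apply_eq_iff]

theorem sum_numOrbits_one [Nonempty α] :
    ∑ σ : Perm α, σ.numOrbits 1 = (Fintype.card α).factorial := by
  simp_rw [numOrbits_one_s6]
  rw [sum_comm]
  simp_rw [← card_filter, card_fixing_one]
  simpa using Nat.mul_factorial_pred Fintype.card_ne_zero

theorem sum_numOrbits_one_sq [Nonempty α] :
    ∑ σ : Perm α, σ.numOrbits 1 * σ.numOrbits 1 =
      (Fintype.card α).factorial * (1 + if Fintype.card α = 1 then 0 else 1) := by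
  have h : ∀ σ : Perm α, σ.numOrbits 1 * σ.numOrbits 1 =
      ∑ x, ∑ y, if σ x = x ∧ σ y = y then 1 else 0 := by
    intro σ
    rw [numOrbits_one_s6, sum_mul_sum]
    refine sum_congr rfl fun x _ => sum_congr rfl fun y _ => ?_
    split_ifs <;> simp_all
  have h' : ∀ x y : α, (∑ σ : Perm α, if σ x = x ∧ σ y = y then 1 else 0) =
      if x = y then (Fintype.card α - 1).factorial else (Fintype.card α - 2).factorial := by
    intro x y
    rw [← card_filter]
    split_ifs with hxy
    · simp [← hxy, card_fixing_one]
    · exact card_fixing_pair hxy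
  simp_rw [h]
  rw [sum_comm, sum_congr rfl fun x _ => sum_comm]
  simp_rw [h']
  rw [sum_ite_eq_const, mul_add, mul_pred_mul_factorial_sub_two Fintype.card_ne_zero,
    Nat.mul_factorial_pred Fintype.card_ne_zero]
  ring

theorem sum_two_mul_numOrbits_two [Nonempty α] :
    ∑ σ : Perm α, 2 * σ.numOrbits 2 =
      (Fintype.card α).factorial * (if Fintype.card α = 1 then 0 else 1) := by
  have h : ∀ x y : α, (∑ σ : Perm α, if x ≠ y ∧ σ x = y ∧ σ y = x then 1 else 0) =
      if x = y then 0 else (Fintype.card α - 2).factorial := by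
    intro x y
    rw [← card_filter]
    split_ifs with hxy
    · simp [hxy]
    · simp [hxy, card_swapping_pair hxy]
  simp_rw [two_mul_numOrbits_two]
  rw [sum_comm, sum_congr rfl fun x _ => sum_comm]
  simp_rw [h]
  rw [sum_ite_eq_const, zero_add, mul_pred_mul_factorial_sub_two Fintype.card_ne_zero]

/-- `2 ^ c(σ)` counts the two-colourings invariant under `σ`. -/
theorem two_pow_numCycles (σ : Perm α) :
    2 ^ σ.numCycles = #{f : α → Bool | f ∘ σ = f} := by
  have hinv : ∀ (f : α → Bool), f ∘ σ = f → ∀ x y, σ.SameCycle x y → f x = f y := by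
    rintro f hf x y h
    obtain ⟨i, rfl⟩ := h.exists_nat_pow_eq
    induction i with
    | zero => rfl
    | succ i ih =>
      rw [pow_succ', mul_apply]
      exact (ih ⟨i, by simp⟩).trans (congrFun hf _).symm
  have e : (Quotient (SameCycle.setoid σ) → Bool) ≃ {f : α → Bool // f ∘ σ = f} :=
    { toFun := fun g => ⟨fun x => g (Quotient.mk _ x), funext fun x =>
        congrArg g (Quotient.sound (sameCycle_apply_left.2 (SameCycle.refl σ x)))⟩
      invFun := fun f => Quotient.lift f.1 (hinv f.1 f.2)
      left_inv := fun g => funext fun ω => Quotient.inductionOn ω fun _ => rfl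
      right_inv := fun f => rfl }
  rw [← Fintype.card_subtype, ← Nat.card_eq_fintype_card, ← Nat.card_congr e, Nat.card_fun]
  simp [numCycles]

theorem sum_two_pow_numCycles :
    ∑ σ : Perm α, 2 ^ σ.numCycles = (Fintype.card α).factorial * (Fintype.card α + 1) := by
  have hf : ∀ s : Finset α, #{σ : Perm α | (fun x => decide (x ∈ s)) ∘ σ = fun x => decide (x ∈ s)}
      = (#s).factorial * (Fintype.card α - #s).factorial := by
    intro s
    rw [← Fintype.card_subtype, DomMulAct.stabilizer_card, Fintype.prod_bool]
    simp [Fintype.card_subtype_compl]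
  let e : Finset α ≃ (α → Bool) :=
    { toFun := fun s x => decide (x ∈ s)
      invFun := fun f => {x | f x = true}
      left_inv := fun s => by simp
      right_inv := fun f => by simp }
  simp_rw [two_pow_numCycles, card_filter]
  rw [sum_comm]
  simp_rw [← card_filter]
  rw [← e.sum_comp]
  simp only [e, Equiv.coe_fn_mk, hf]
  rw [← powerset_univ, sum_powerset_apply_card
    (fun k => k.factorial * (Fintype.card α - k).factorial), card_univ]
  rw [sum_congr rfl fun k hk => ?_, sum_const, card_range, smul_eq_mul, mul_comm]
  rw [smul_eq_mul, ← mul_assoc, Nat.choose_mul_factorial_mul_factorial (by grind)]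

end Equiv.Perm

section Product

variable {ι : Type*} [Fintype ι] [DecidableEq ι] {κ : ι → Type*} [∀ i, Fintype (κ i)]

theorem sum_prod_eq_of_sum_eq {F : (i : ι) → κ i → ℤ} {A m : ι → ℤ}
    (h : ∀ i, ∑ x, F i x = A i * m i) :
    ∑ σ : (i : ι) → κ i, ∏ i, F i (σ i) = (∏ i, A i) * ∏ i, m i := by
  rw [← Fintype.prod_sum, ← prod_mul_distrib]
  exact prod_congr rfl fun i _ => h i

theorem sum_apply_eq_of_sum_eq {A : ι → ℤ} (hA : ∀ i, (Fintype.card (κ i) : ℤ) = A i) (i : ι)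
    {g : κ i → ℤ} {m : ℤ} (h : ∑ x, g x = A i * m) :
    ∑ σ : (i : ι) → κ i, g (σ i) = (∏ i, A i) * m := by
  have key := sum_prod_eq_of_sum_eq (A := A) (m := Function.update 1 i m)
    (F := Function.update (fun _ _ => 1) i g) fun k => by
      obtain rfl | hk := eq_or_ne k i
      · simpa using h
      · simp [hk, hA]
  rw [prod_update_of_mem (mem_univ i)] at key
  simp only [Pi.one_apply, prod_const_one, mul_one] at key
  rw [← key]
  refine sum_congr rfl fun σ _ => ?_
  rw [Fintype.prod_eq_single i]
  · simp
  · intro k hk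
    simp [hk]

theorem sum_apply_mul_apply_eq_of_sum_eq {A : ι → ℤ}
    (hA : ∀ i, (Fintype.card (κ i) : ℤ) = A i) {f : (i : ι) → κ i → ℤ}
    (hf : ∀ i, ∑ x, f i x = A i) {i j : ι} (hij : i ≠ j) :
    ∑ σ : (i : ι) → κ i, f i (σ i) * f j (σ j) = ∏ i, A i := by
  have key := sum_prod_eq_of_sum_eq (A := A) (m := 1)
    (F := fun k x => if k ∈ ({i, j} : Finset ι) then f k x else 1) fun k => by
      split_ifs
      · simp [hf]
      · simp [hA]
  simp only [Pi.one_apply, prod_const_one, mul_one] at key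
  rw [← key]
  refine sum_congr rfl fun σ _ => ?_
  rw [prod_ite_mem, univ_inter, prod_pair hij]

end Product

/-- Averaging identity for the traces on `H²(M₀,ₙ₊ₐ₁₊⋯₊ₐₗ)`: for `n ≥ 1`, `l ≥ 1`
and positive integers `a₁, …, a_l`, the sum over tuples of permutations
`σᵢ ∈ S_{aᵢ}` of `2^{n-1+∑c(σᵢ)} - 1 - ∑n₂(σᵢ) - C(n + ∑n₁(σᵢ), 2)` equals
`a₁!⋯a_l! (2^{n-1}(a₁+1)⋯(a_l+1) - 1 - (l - 𝔞) - C(n,2) - nl - C(l,2))`,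
where `𝔞` is the number of indices with `aᵢ = 1`. -/
theorem sum_traces_identity (n l : ℕ) (hn : 1 ≤ n) (hl : 1 ≤ l)
    (a : Fin l → ℕ) (ha : ∀ i, 1 ≤ a i) :
    ∑ σ : (i : Fin l) → Equiv.Perm (Fin (a i)),
      ((2 : ℤ) ^ (n - 1 + ∑ i, (σ i).numCycles) - 1
        - ∑ i, ((σ i).numOrbits 2 : ℤ)
        - Nat.choose (n + ∑ i, (σ i).numOrbits 1) 2) =
      (∏ i, (Nat.factorial (a i) : ℤ)) *
        ((2 : ℤ) ^ (n - 1) * ∏ i, ((a i : ℤ) + 1) - 1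
          - ((l : ℤ) - ((Finset.univ.filter fun i => a i = 1).card : ℤ))
          - Nat.choose n 2 - (n : ℤ) * l - Nat.choose l 2) := by
  have := fun i => Fin.pos_iff_nonempty.1 (ha i)
  have hA : ∀ i, (Fintype.card (Equiv.Perm (Fin (a i))) : ℤ) = (a i).factorial := by
    simp [Fintype.card_perm]
  set P : ℤ := ∏ i, ((a i).factorial : ℤ)
  let δ : Fin l → ℤ := fun i => if a i = 1 then 0 else 1
  have hδ : ∑ i, δ i = (l : ℤ) - #{i | a i = 1} := by
    have h : ∀ i, δ i = 1 - if a i = 1 then 1 else 0 := fun i => by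
      simp only [δ]; split_ifs <;> rfl
    simp [h]
  have hcard : ∑ _σ : (i : Fin l) → Equiv.Perm (Fin (a i)), (1 : ℤ) = P := by
    simp [Fintype.card_perm, P]
  have hpow : ∑ σ : (i : Fin l) → Equiv.Perm (Fin (a i)),
      (2 : ℤ) ^ (n - 1 + ∑ i, (σ i).numCycles) = P * (2 ^ (n - 1) * ∏ i, ((a i : ℤ) + 1)) := by
    simp_rw [pow_add, ← prod_pow_eq_pow_sum]
    rw [← mul_sum, sum_prod_eq_of_sum_eq (F := fun i (τ : Equiv.Perm (Fin (a i))) =>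
      2 ^ τ.numCycles) (A := fun i => (a i).factorial) (m := fun i => (a i : ℤ) + 1)]
    · ring
    · intro i
      simpa using congrArg (Nat.cast (R := ℤ)) (Equiv.Perm.sum_two_pow_numCycles (α := Fin (a i)))
  have hone : ∀ i, ∑ τ : Equiv.Perm (Fin (a i)), (τ.numOrbits 1 : ℤ) = (a i).factorial := by
    intro i
    simpa using congrArg (Nat.cast (R := ℤ)) (Equiv.Perm.sum_numOrbits_one (α := Fin (a i)))
  have htwo : ∑ σ : (i : Fin l) → Equiv.Perm (Fin (a i)),
      2 * ∑ i, ((σ i).numOrbits 2 : ℤ) = P * ∑ i, δ i := by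
    simp_rw [mul_sum]
    rw [sum_comm]
    refine sum_congr rfl fun i _ => ?_
    refine sum_apply_eq_of_sum_eq hA i (g := fun τ => 2 * (τ.numOrbits 2 : ℤ)) ?_
    simpa [δ] using congrArg (Nat.cast (R := ℤ)) (Equiv.Perm.sum_two_mul_numOrbits_two (α := Fin (a i)))
  have hlin : ∑ σ : (i : Fin l) → Equiv.Perm (Fin (a i)),
      ∑ i, ((σ i).numOrbits 1 : ℤ) = P * l := by
    rw [sum_comm, sum_congr rfl fun i _ => sum_apply_eq_of_sum_eq hA i
      (g := fun τ => (τ.numOrbits 1 : ℤ)) (m := 1) (by rw [hone, mul_one])]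
    simp [P, mul_comm]
  have hsq : ∑ σ : (i : Fin l) → Equiv.Perm (Fin (a i)),
      (∑ i, ((σ i).numOrbits 1 : ℤ)) * ∑ i, ((σ i).numOrbits 1 : ℤ) =
        P * (l * l + ∑ i, δ i) := by
    have h : ∀ i j, ∑ σ : (i : Fin l) → Equiv.Perm (Fin (a i)),
        ((σ i).numOrbits 1 : ℤ) * (σ j).numOrbits 1 = P * (1 + if i = j then δ i else 0) := by
      intro i j
      obtain rfl | hij := eq_or_ne i j
      · refine sum_apply_eq_of_sum_eq hA i
          (g := fun τ => (τ.numOrbits 1 : ℤ) * τ.numOrbits 1) ?_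
        simpa [δ] using congrArg (Nat.cast (R := ℤ)) (Equiv.Perm.sum_numOrbits_one_sq (α := Fin (a i)))
      · rw [if_neg hij, add_zero, mul_one]
        exact sum_apply_mul_apply_eq_of_sum_eq hA
          (f := fun i (τ : Equiv.Perm (Fin (a i))) => (τ.numOrbits 1 : ℤ)) hone hij
    simp_rw [sum_mul_sum]
    rw [sum_comm, sum_congr rfl fun i _ => sum_comm]
    simp_rw [h, ← mul_sum, sum_add_distrib]
    simp
  rw [← hδ]
  refine mul_left_cancel₀ (two_ne_zero (α := ℤ)) ?_
  have hterm : ∀ σ : (i : Fin l) → Equiv.Perm (Fin (a i)),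
      2 * ((2 : ℤ) ^ (n - 1 + ∑ i, (σ i).numCycles) - 1
        - ∑ i, ((σ i).numOrbits 2 : ℤ)
        - Nat.choose (n + ∑ i, (σ i).numOrbits 1) 2) =
      2 * (2 : ℤ) ^ (n - 1 + ∑ i, (σ i).numCycles) - (2 + n * (n - 1)) * 1
        - 2 * ∑ i, ((σ i).numOrbits 2 : ℤ)
        - (2 * n - 1) * ∑ i, ((σ i).numOrbits 1 : ℤ)
        - (∑ i, ((σ i).numOrbits 1 : ℤ)) * ∑ i, ((σ i).numOrbits 1 : ℤ) := by
    intro σ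
    have h := two_mul_choose_two (n + ∑ i, (σ i).numOrbits 1)
    push_cast at h
    linear_combination -h
  rw [mul_sum, sum_congr rfl fun σ _ => hterm σ]
  simp only [sum_sub_distrib]
  rw [htwo, hsq, ← mul_sum, ← mul_sum, ← mul_sum, hpow, hcard, hlin]
  linear_combination P * two_mul_choose_two n + P * two_mul_choose_two l
end

section
/- Let n ≥ 0, l ≥ 1, and let d = (d_1, …, d_l) be a tuple of natural numbers, not all zero. Consider ordered pairs ((A, e), (A^c, d − e)) where A is a subset of {1, …, n}, A^c is its complement, and e = (e_1, …, e_l) is a tuple of natural numbers with e_i ≤ d_i for all i; call such a pair stable if it is not the case that e = 0 and |A| ≤ 1, and not the case that e = d and |A^c| ≤ 1. Then the number of such stable pairs, counted up to interchanging the two factors (i.e. identifying ((A,e),(A^c,d−e)) with ((A^c,d−e),(A,e))), equals ⌈ 2^n (d_1+1)⋯(d_l+1) / 2 ⌉ − 1 − n. -/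
open Finset in
/-- An involution with at most one fixed point on a finite set `S` has `⌈|S| / 2⌉` orbits. -/
theorem card_image_sym2_of_involutive {α : Type*} [DecidableEq α] (S : Finset α) (σ : α → α)
    (hmem : ∀ x ∈ S, σ x ∈ S) (hinv : ∀ x ∈ S, σ (σ x) = x)
    (hfix : ∀ x ∈ S, ∀ y ∈ S, σ x = x → σ y = y → x = y) :
    (S.image fun x => s(x, σ x)).card = (S.card + 1) / 2 := by
  have key : (S.image fun x => s(x, σ x)).card * 2 =
      S.card + (S.filter fun x => σ x = x).card := by
    rw [← sum_const_nat (f := fun _ => 2) fun _ _ => rfl, card_filter, card_eq_sum_ones,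
      ← sum_add_distrib]
    refine sum_image' _ fun x hx => ?_
    have hfiber : (S.filter fun y => s(y, σ y) = s(x, σ x)) = {x, σ x} := by
      ext y
      simp only [mem_filter, mem_insert, mem_singleton, Sym2.eq_iff]
      constructor
      · tauto
      · rintro (rfl | rfl)
        · exact ⟨hx, Or.inl ⟨rfl, rfl⟩⟩
        · exact ⟨hmem x hx, Or.inr ⟨rfl, hinv x hx⟩⟩
    rw [hfiber]
    by_cases h : σ x = x
    · simp [h]
    · rw [sum_pair (Ne.symm h)]
      simp [h, hinv x hx, Ne.symm h]
  have hle : (S.filter fun x => σ x = x).card ≤ 1 := by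
    refine card_le_one.2 fun x hx y hy => ?_
    rw [mem_filter] at hx hy
    exact hfix x hx.1 y hy.1 hx.2 hy.2
  omega

open Finset in
theorem card_filter_card_le_one (n : ℕ) :
    (univ.filter fun A : Finset (Fin n) => A.card ≤ 1).card = n + 1 := by
  have h : (univ.filter fun A : Finset (Fin n) => A.card ≤ 1) =
      insert ∅ (univ.image fun i : Fin n => ({i} : Finset (Fin n))) := by
    ext A
    simp only [mem_filter, mem_univ, true_and, mem_insert, mem_image,
      Nat.le_one_iff_eq_zero_or_eq_one,
      card_eq_zero, card_eq_one, eq_comm]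
  rw [h, card_insert_of_notMem (by simp), card_image_of_injective _ singleton_injective]
  simp

open Finset in
theorem card_filter_card_compl_le_one (n : ℕ) :
    (univ.filter fun A : Finset (Fin n) => Aᶜ.card ≤ 1).card = n + 1 := by
  rw [← card_filter_card_le_one n]
  exact card_nbij' compl compl (by intro A; simp) (by intro A; simp) (by intro A; simp)
    (by intro A; simp)

open Finset in
/-- The ordered stable pairs, recorded by their first factor. -/
def stablePairs (n l : ℕ) (d : Fin l → ℕ) : Finset (Finset (Fin n) × (Fin l → ℕ)) :=
  (univ ×ˢ Iic d).filter fun x => ¬(x.2 = 0 ∧ x.1.card ≤ 1) ∧ ¬(x.2 = d ∧ x.1ᶜ.card ≤ 1)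

open Finset in
theorem card_stablePairs_add (n l : ℕ) (d : Fin l → ℕ) (hd : d ≠ 0) :
    (stablePairs n l d).card + 2 * (n + 1) = 2 ^ n * ∏ i, (d i + 1) := by
  have htot : ((univ : Finset (Finset (Fin n))) ×ˢ Iic d).card = 2 ^ n * ∏ i, (d i + 1) := by
    simp [card_product, Pi.card_Iic]
  have hunstable : (((univ : Finset (Finset (Fin n))) ×ˢ Iic d).filter fun x =>
      ¬(¬(x.2 = 0 ∧ x.1.card ≤ 1) ∧ ¬(x.2 = d ∧ x.1ᶜ.card ≤ 1))) =
      (univ.filter fun A : Finset (Fin n) => A.card ≤ 1) ×ˢ {0} ∪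
        (univ.filter fun A : Finset (Fin n) => Aᶜ.card ≤ 1) ×ˢ {d} := by
    ext ⟨A, e⟩
    simp only [mem_filter, mem_product, mem_univ, true_and, mem_Iic, mem_union, mem_singleton]
    constructor
    · tauto
    · rintro (⟨h, rfl⟩ | ⟨h, rfl⟩)
      · exact ⟨zero_le, by tauto⟩
      · exact ⟨le_rfl, by tauto⟩
  have hdisj : Disjoint
      ((univ.filter fun A : Finset (Fin n) => A.card ≤ 1) ×ˢ ({0} : Finset (Fin l → ℕ)))
      ((univ.filter fun A : Finset (Fin n) => Aᶜ.card ≤ 1) ×ˢ {d}) :=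
    disjoint_product.2 (Or.inr (by simpa using hd.symm))
  have hcard := congrArg card hunstable
  rw [card_union_of_disjoint hdisj, card_product, card_product, card_filter_card_le_one,
    card_filter_card_compl_le_one, card_singleton, card_singleton] at hcard
  rw [← htot, ← card_filter_add_card_filter_not (s := univ ×ˢ Iic d)
    fun x : Finset (Fin n) × (Fin l → ℕ) =>
      ¬(x.2 = 0 ∧ x.1.card ≤ 1) ∧ ¬(x.2 = d ∧ x.1ᶜ.card ≤ 1), hcard, stablePairs]
  ring

open Finset in
theorem card_image_stablePairs (n l : ℕ) (d : Fin l → ℕ) :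
    ((stablePairs n l d).image fun x : Finset (Fin n) × (Fin l → ℕ) =>
      s(x, (x.1ᶜ, fun i => d i - x.2 i))).card =
      ((stablePairs n l d).card + 1) / 2 := by
  refine card_image_sym2_of_involutive _
    (fun x : Finset (Fin n) × (Fin l → ℕ) => (x.1ᶜ, fun i => d i - x.2 i)) ?_ ?_ ?_
  · rintro ⟨A, e⟩ h
    simp only [stablePairs, mem_filter, mem_product, mem_univ, true_and, mem_Iic,
      compl_compl] at h ⊢
    obtain ⟨hle, h0, h1⟩ := h
    refine ⟨fun i => Nat.sub_le _ _, fun ⟨h, hA⟩ => h1 ⟨?_, hA⟩, fun ⟨h, hA⟩ => h0 ⟨?_, hA⟩⟩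
    · funext i
      have := congrFun h i
      have := hle i
      simp only [Pi.zero_apply] at *
      omega
    · funext i
      have := congrFun h i
      have := hle i
      simp only [Pi.zero_apply] at *
      omega
  · rintro ⟨A, e⟩ h
    simp only [stablePairs, mem_filter, mem_product, mem_univ, true_and, mem_Iic] at h
    ext1
    · simp
    · funext i
      exact Nat.sub_sub_self (h.1 i)
  · rintro ⟨A, e⟩ h ⟨B, f⟩ h' hA hB
    simp only [stablePairs, mem_filter, mem_product, mem_univ, true_and, mem_Iic] at h h'
    simp only [Prod.mk.injEq] at hA hB
    ext1
    · ext i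
      have := congrArg (i ∈ ·) hA.1
      simp at this
    · funext i
      have := congrFun hA.2 i
      have := congrFun hB.2 i
      have := h.1 i
      have := h'.1 i
      simp only at *
      omega


/-- Count of boundary divisors of the moduli space of `n`-pointed genus-zero stable maps
of multidegree `d = (d₁, …, d_l)` (not all zero): the number of stable pairs
`((A, e), (Aᶜ, d - e))`, where `A ⊆ {1, …, n}` and `0 ≤ e ≤ d` componentwise, counted up
to interchanging the two factors (encoded as unordered pairs in `Sym2`), where a pair is
stable if it is not the case that `e = 0` and `|A| ≤ 1`, and not the case that `e = d`
and `|Aᶜ| ≤ 1`. This number equals `⌈2ⁿ(d₁+1)⋯(d_l+1)/2⌉ - 1 - n`. -/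
theorem count_stable_boundary_divisors (n l : ℕ) (hl : 1 ≤ l)
    (d : Fin l → ℕ) (hd : d ≠ 0) :
    (Nat.card {z : Sym2 (Finset (Fin n) × (Fin l → ℕ)) //
        ∃ (A : Finset (Fin n)) (e : Fin l → ℕ), (∀ i, e i ≤ d i) ∧
          ¬(e = 0 ∧ A.card ≤ 1) ∧ ¬(e = d ∧ Aᶜ.card ≤ 1) ∧
          z = s((A, e), (Aᶜ, fun i => d i - e i))} : ℤ) =
      ⌈((2 : ℚ) ^ n * ∏ i, ((d i : ℚ) + 1)) / 2⌉ - 1 - n := by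
  have hadd := card_stablePairs_add n l d hd
  have hcast : ((2 : ℚ) ^ n * ∏ i, ((d i : ℚ) + 1)) =
      (((stablePairs n l d).card + 2 * (n + 1) : ℕ) : ℚ) := by
    rw [hadd]
    push_cast
    rfl
  have hceil : ⌈((2 : ℚ) ^ n * ∏ i, ((d i : ℚ) + 1)) / 2⌉ =
      (((stablePairs n l d).card + 1) / 2 + (n + 1) : ℕ) := by
    rw [hcast, Int.ceil_eq_iff]
    obtain ⟨k, hk | hk⟩ := Nat.even_or_odd' (stablePairs n l d).card
    · rw [show ((stablePairs n l d).card + 1) / 2 = k by omega, hk]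
      push_cast
      constructor <;> linarith
    · rw [show ((stablePairs n l d).card + 1) / 2 = k + 1 by omega, hk]
      push_cast
      constructor <;> linarith
  rw [hceil, Nat.subtype_card ((stablePairs n l d).image
    fun x : Finset (Fin n) × (Fin l → ℕ) => s(x, (x.1ᶜ, fun i => d i - x.2 i))),
    card_image_stablePairs]
  · push_cast
    ring
  · intro z
    simp only [stablePairs, Finset.mem_image, Finset.mem_filter, Finset.mem_product,
      Finset.mem_univ, true_and, Finset.mem_Iic, Prod.exists, Pi.le_def, and_assoc,
      eq_comm (a := z)]
end
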